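/- arXiv:2511.09024 — 2 statements merged into one kernel-verified Lean document; each statement's English description precedes it below -/
import Mathlib

section
/- Let (Ω, P) be a probability space, let 0 < a < b < ∞ and K > 0, and let W be a positive real-valued random variable satisfying P(W ≥ t) ≤ exp(−t²/K²) for all t ≥ 0. Then there exist absolute constants C₁, C₂, C₃ > 0 (not depending on a, b, K, W, or r) such that for every r ≥ 1 the random variable X = 1/(a + max(0, b − W)) satisfies (E[X^r])^{1/r} ≤ 2/b + C₁ r^{1/r} K^{1/r} b^{−2(1+1/r)} exp(C₂ K² (r+1)² (log(a/b))² / (r (b−a)²)) + a^{−1} exp(−C₃ b² / (r K²)). -/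
open MeasureTheory

/-- The three-term bound `γ(r; a, b, K) = γ_head + γ_body + γ_tail` from the
three-way integral proposition, with absolute constants `C₁, C₂, C₃`. -/
noncomputable def gammaBound (C₁ C₂ C₃ : ℝ) (r a b K : ℝ) : ℝ :=
  2 / b
  + C₁ * r ^ (1 / r) * K ^ (1 / r) * b ^ (-(2 * (1 + 1 / r)))
      * Real.exp (C₂ * K ^ 2 * (r + 1) ^ 2 * (Real.log (a / b)) ^ 2 / (r * (b - a) ^ 2))
  + a⁻¹ * Real.exp (-(C₃ * b ^ 2) / (r * K ^ 2))

/-- **Three-way integral.** There exist absolute constants `C₁, C₂, C₃ > 0` such that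
for every probability space `(Ω, P)`, all `0 < a < b` and `K > 0`, and every positive
random variable `W` with subgaussian tail `P(W ≥ t) ≤ exp(−t²/K²)`, the random variable
`X = 1/(a + max(0, b − W))` satisfies `(E[X^r])^{1/r} ≤ γ(r; a, b, K)` for all `r ≥ 1`. -/
theorem three_way_integral :
    ∃ C₁ > (0 : ℝ), ∃ C₂ > (0 : ℝ), ∃ C₃ > (0 : ℝ),
      ∀ (Ω : Type) (_ : MeasurableSpace Ω) (P : Measure Ω) (_ : IsProbabilityMeasure P)
        (a b K : ℝ) (W : Ω → ℝ),
        0 < a → a < b → 0 < K →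
        Measurable W →
        (∀ ω, 0 < W ω) →
        (∀ t : ℝ, 0 ≤ t → (P {ω | t ≤ W ω}).toReal ≤ Real.exp (-t ^ 2 / K ^ 2)) →
        ∀ r : ℝ, 1 ≤ r →
          (∫ ω, (1 / (a + max 0 (b - W ω))) ^ r ∂P) ^ (1 / r)
            ≤ gammaBound C₁ C₂ C₃ r a b K := by
  refine ⟨1, one_pos, 1, one_pos, 1 / 4, by norm_num, ?_⟩
  intro Ω _ P _ a b K W ha hab hK hW hpos htail r hr
  have hb : 0 < b := ha.trans hab
  have hr0 : 0 < r := by linarith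
  have hE : MeasurableSet {ω | b / 2 ≤ W ω} := measurableSet_le measurable_const hW
  set E : Set Ω := {ω | b / 2 ≤ W ω} with hEdef
  have hden : ∀ ω, 0 < a + max 0 (b - W ω) := fun ω => by
    have := le_max_left 0 (b - W ω)
    linarith
  have hint : Integrable (fun ω => (2 / b) ^ r + E.indicator (fun _ => (a⁻¹) ^ r) ω) P :=
    (integrable_const _).add ((integrable_const _).indicator hE)
  have h1 : ∫ ω, (1 / (a + max 0 (b - W ω))) ^ r ∂P
      ≤ ∫ ω, ((2 / b) ^ r + E.indicator (fun _ => (a⁻¹) ^ r) ω) ∂P := by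
    apply integral_mono_of_nonneg _ hint
    · refine Filter.Eventually.of_forall fun ω => ?_
      have := hden ω
      dsimp only
      by_cases h : ω ∈ E
      · rw [Set.indicator_of_mem h]
        have h2 : (1 / (a + max 0 (b - W ω))) ^ r ≤ (a⁻¹) ^ r := by
          apply Real.rpow_le_rpow (by positivity) _ hr0.le
          rw [← one_div]
          apply one_div_le_one_div_of_le ha
          have := le_max_left 0 (b - W ω)
          linarith
        have : 0 ≤ (2 / b) ^ r := by positivity
        linarith
      · rw [Set.indicator_of_notMem h, add_zero]
        have h' : W ω < b / 2 := not_le.mp h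
        apply Real.rpow_le_rpow (by positivity) _ hr0.le
        rw [div_le_div_iff₀ this hb]
        have := le_max_right 0 (b - W ω)
        linarith
    · refine Filter.Eventually.of_forall fun ω => ?_
      have := hden ω
      show 0 ≤ (1 / (a + max 0 (b - W ω))) ^ r
      positivity
  have h2 : ∫ ω, ((2 / b) ^ r + E.indicator (fun _ => (a⁻¹) ^ r) ω) ∂P
      = (2 / b) ^ r + (P E).toReal * (a⁻¹) ^ r := by
    rw [integral_add (integrable_const _) ((integrable_const _).indicator hE),
      integral_indicator_const _ hE]
    simp [Measure.real]
  have h3 : (P E).toReal ≤ Real.exp (-(b / 2) ^ 2 / K ^ 2) := htail (b / 2) (by positivity)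
  have h4 : ∫ ω, (1 / (a + max 0 (b - W ω))) ^ r ∂P
      ≤ (2 / b) ^ r + (a⁻¹ * Real.exp (-(1 / 4 * b ^ 2) / (r * K ^ 2))) ^ r := by
    rw [Real.mul_rpow (by positivity) (Real.exp_pos _).le, ← Real.exp_mul]
    have he : -(1 / 4 * b ^ 2) / (r * K ^ 2) * r = -(b / 2) ^ 2 / K ^ 2 := by
      field_simp
      ring
    rw [he]
    have : (P E).toReal * (a⁻¹) ^ r ≤ Real.exp (-(b / 2) ^ 2 / K ^ 2) * (a⁻¹) ^ r :=
      mul_le_mul_of_nonneg_right h3 (by positivity)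
    linarith
  have h0 : 0 ≤ ∫ ω, (1 / (a + max 0 (b - W ω))) ^ r ∂P :=
    integral_nonneg fun ω => by
      have := hden ω
      show 0 ≤ (1 / (a + max 0 (b - W ω))) ^ r
      positivity
  have hy : 0 ≤ a⁻¹ * Real.exp (-(1 / 4 * b ^ 2) / (r * K ^ 2)) := by positivity
  have hx : 0 ≤ 2 / b := by positivity
  have h5 : (∫ ω, (1 / (a + max 0 (b - W ω))) ^ r ∂P) ^ (1 / r)
      ≤ 2 / b + a⁻¹ * Real.exp (-(1 / 4 * b ^ 2) / (r * K ^ 2)) := by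
    rw [one_div r, Real.rpow_inv_le_iff_of_pos h0 (by positivity) hr0]
    exact h4.trans (Real.add_rpow_le_rpow_add hx hy hr)
  have hbody : 0 ≤ 1 * r ^ (1 / r) * K ^ (1 / r) * b ^ (-(2 * (1 + 1 / r)))
      * Real.exp (1 * K ^ 2 * (r + 1) ^ 2 * (Real.log (a / b)) ^ 2 / (r * (b - a) ^ 2)) := by
    positivity
  unfold gammaBound
  linarith
end

section
/- Let p > d ≥ 0 be integers, let N ≥ 1 be an integer, h > 0, i₀ ∈ [0, N], and x ∈ ℝ. Let D ∈ ℝ^N be coefficients such that for every real polynomial g of degree at most p − 1, Σ_{k=1}^N D_k g(kh) = g^{(d)}(i₀h). Let f be p-times continuously differentiable on [x, x + Nh] and set R_p = sup_{t ∈ [x, x+Nh]} |f^{(p)}(t)|. Then | f^{(d)}(x + i₀h) − Σ_{k=1}^N D_k f(x + kh) | ≤ ‖D‖₂ · √N · R_p · (Nh)^p / p!, where ‖D‖₂ = (Σ_k D_k²)^{1/2}. -/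
open Set in
lemma aux_taylor_bound (n : ℕ) (f : ℝ → ℝ) (a b : ℝ) (hab : a < b)
    (hf : ContDiffOn ℝ ((n + 1 : ℕ)) f (Icc a b)) (R : ℝ)
    (hR : ∀ t ∈ Icc a b, |iteratedDerivWithin (n + 1) f (Icc a b) t| ≤ R)
    (c y : ℝ) (hc : c ∈ Icc a b) (hy : y ∈ Icc a b) :
    |f y - taylorWithinEval f n (Icc a b) c y| ≤ R * (b - a) ^ (n + 1) / (n + 1).factorial := by
  have hR0 : 0 ≤ R := (abs_nonneg _).trans (hR c hc)
  have hba : 0 ≤ b - a := by linarith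
  by_cases hcy : c = y
  · subst hcy
    rw [taylorWithinEval_self, sub_self, abs_zero]
    positivity
  have hsub : uIcc c y ⊆ Icc a b := uIcc_subset_Icc hc hy
  have hu : UniqueDiffOn ℝ (uIcc c y) := uniqueDiffOn_uIcc hcy
  have hU : UniqueDiffOn ℝ (Icc a b) := uniqueDiffOn_Icc hab
  have key : ∀ m ≤ n + 1, ∀ t ∈ uIcc c y,
      iteratedDerivWithin m f (uIcc c y) t = iteratedDerivWithin m f (Icc a b) t := by
    intro m hm t ht
    rw [iteratedDerivWithin_eq_iteratedFDerivWithin, iteratedDerivWithin_eq_iteratedFDerivWithin,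
      iteratedFDerivWithin_subset hsub hu hU (hf.of_le (by exact_mod_cast hm)) ht]
  have hf2 : ContDiffOn ℝ ((n + 1 : ℕ)) f (uIcc c y) := hf.mono hsub
  have hd : DifferentiableOn ℝ (iteratedDerivWithin n f (uIcc c y)) (uIcc c y) :=
    hf2.differentiableOn_iteratedDerivWithin (by exact_mod_cast Nat.lt_succ_self n) hu
  obtain ⟨t, ht, h2⟩ := taylor_mean_remainder_lagrange hcy
    (hf2.of_le (by exact_mod_cast Nat.le_succ n)) (hd.mono Ioo_subset_Icc_self)
  have ht' : t ∈ uIcc c y := Ioo_subset_Icc_self ht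
  have e : taylorWithinEval f n (uIcc c y) c y = taylorWithinEval f n (Icc a b) c y := by
    rw [taylor_within_apply, taylor_within_apply]
    refine Finset.sum_congr rfl fun m hm => ?_
    rw [key m (Finset.mem_range.1 hm).le c left_mem_uIcc]
  rw [← e, h2, key _ le_rfl t ht', abs_div, abs_mul, abs_pow, Nat.abs_cast]
  have h3 : |y - c| ≤ b - a := by
    rw [abs_le]; constructor <;> linarith [hc.1, hc.2, hy.1, hy.2]
  have h4 := hR t (hsub ht')
  gcongr

open Polynomial in
lemma aux_poly (n : ℕ) (A : ℕ → ℝ) (c : ℝ) : ∃ g : ℝ[X], g.degree ≤ n ∧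
    (∀ y, g.eval y = ∑ j ∈ Finset.range (n + 1), (((j.factorial : ℝ))⁻¹ * (y - c) ^ j) * A j) ∧
    ∀ d ≤ n, ((⇑derivative)^[d] g).eval c = A d := by
  let q : ℝ[X] := ∑ j ∈ Finset.range (n + 1), monomial j ((j.factorial : ℝ)⁻¹ * A j)
  refine ⟨taylor (-c) q, ?_, ?_, ?_⟩
  · rw [degree_taylor]
    rw [← mem_degreeLE]
    refine Submodule.sum_mem _ fun j hj => ?_
    rw [mem_degreeLE]
    refine (degree_monomial_le _ _).trans ?_
    exact_mod_cast Nat.lt_succ_iff.1 (Finset.mem_range.1 hj)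
  · intro y
    rw [taylor_eval, eval_finsetSum]
    refine Finset.sum_congr rfl fun j _ => ?_
    rw [eval_monomial]; ring
  · intro d hd
    rw [← factorial_smul_hasseDeriv, LinearMap.smul_apply, eval_smul, ← taylor_coeff, taylor_taylor,
      add_neg_cancel, taylor_zero]
    have : q.coeff d = (d.factorial : ℝ)⁻¹ * A d := by
      simp only [q, finsetSum_coeff, coeff_monomial]
      rw [Finset.sum_ite_eq' ]
      simp [Nat.lt_succ_iff.2 hd]
    rw [this, nsmul_eq_mul]
    have : (d.factorial : ℝ) ≠ 0 := by positivity
    field_simp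

/-- **Bias of a local polynomial filter.** Let `p > d ≥ 0`, `N ≥ 1`, `h > 0`,
`i₀ ∈ [0, N]`, `x ∈ ℝ`. Suppose the coefficients `D` reproduce the `d`-th derivative at
`i₀h` from the samples at `kh`, `k = 1, …, N`, exactly on polynomials of degree at most
`p − 1`. If `f` is `C^p` on `[x, x + Nh]` with `|f^{(p)}| ≤ R_p` there, then
`|f^{(d)}(x + i₀h) − Σ_k D_k f(x + kh)| ≤ ‖D‖₂ √N R_p (Nh)^p / p!`. -/
theorem local_polynomial_filter_bias
    (p d N : ℕ) (hdp : d < p) (hN : 1 ≤ N) (h : ℝ) (hh : 0 < h)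
    (i₀ : ℝ) (hi₀ : i₀ ∈ Set.Icc (0 : ℝ) N) (x : ℝ)
    (D : Fin N → ℝ)
    (hD : ∀ g : Polynomial ℝ, g.degree ≤ (p - 1 : ℕ) →
      ∑ k : Fin N, D k * g.eval (((k : ℕ) + 1) * h)
        = ((⇑Polynomial.derivative)^[d] g).eval (i₀ * h))
    (f : ℝ → ℝ) (hf : ContDiffOn ℝ p f (Set.Icc x (x + N * h)))
    (Rp : ℝ)
    (hRp : ∀ t ∈ Set.Icc x (x + N * h),
      |iteratedDerivWithin p f (Set.Icc x (x + N * h)) t| ≤ Rp) :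
    |iteratedDerivWithin d f (Set.Icc x (x + N * h)) (x + i₀ * h)
        - ∑ k : Fin N, D k * f (x + ((k : ℕ) + 1) * h)|
      ≤ Real.sqrt (∑ k, D k ^ 2) * Real.sqrt N * Rp * ((N : ℝ) * h) ^ p
          / (Nat.factorial p) := by
  obtain ⟨n, rfl⟩ : ∃ n, p = n + 1 := ⟨p - 1, by omega⟩
  have hN0 : (0 : ℝ) < N := by exact_mod_cast hN
  have hNh : 0 < (N : ℝ) * h := by positivity
  have hc : x + i₀ * h ∈ Set.Icc x (x + N * h) := by
    have h1 := mul_nonneg hi₀.1 hh.le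
    have h2 := mul_le_mul_of_nonneg_right hi₀.2 hh.le
    constructor <;> linarith
  have hy : ∀ k : Fin N, x + ((k : ℕ) + 1) * h ∈ Set.Icc x (x + N * h) := by
    intro k
    have h0 : ((k : ℕ) : ℝ) + 1 ≤ N := by exact_mod_cast k.2
    have h1 : 0 ≤ (((k : ℕ) : ℝ) + 1) * h := by positivity
    have h2 := mul_le_mul_of_nonneg_right h0 hh.le
    constructor <;> linarith
  have hb := fun k => aux_taylor_bound n f x (x + N * h) (by linarith) hf Rp hRp _ _ hc (hy k)
  obtain ⟨g, hg1, hg2, hg3⟩ := aux_poly n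
    (fun j => iteratedDerivWithin j f (Set.Icc x (x + N * h)) (x + i₀ * h)) (i₀ * h)
  have hDg := hD g (by simpa using hg1)
  rw [hg3 d (by omega)] at hDg
  have hT : ∀ k : Fin N, g.eval (((k : ℕ) + 1) * h) = taylorWithinEval f n
      (Set.Icc x (x + N * h)) (x + i₀ * h) (x + ((k : ℕ) + 1) * h) := by
    intro k
    rw [hg2, taylor_within_apply]
    refine Finset.sum_congr rfl fun j _ => ?_
    rw [smul_eq_mul, add_sub_add_left_eq_sub]
  rw [← hDg, ← Finset.sum_sub_distrib]
  have hR0 : 0 ≤ Rp := (abs_nonneg _).trans (hRp _ hc)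
  set B := Rp * ((N : ℝ) * h) ^ (n + 1) / (n + 1).factorial with hB
  have hB0 : 0 ≤ B := by positivity
  calc _ ≤ ∑ k : Fin N, |D k| * B := by
        refine (Finset.abs_sum_le_sum_abs _ _).trans (Finset.sum_le_sum fun k _ => ?_)
        rw [← mul_sub, abs_mul, hT, abs_sub_comm]
        have := hb k
        rw [add_sub_cancel_left] at this
        gcongr
    _ = (∑ k : Fin N, |D k| * 1) * B := by simp [Finset.sum_mul]
    _ ≤ (Real.sqrt (∑ k, |D k| ^ 2) * Real.sqrt (∑ k : Fin N, (1 : ℝ) ^ 2)) * B := by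
        gcongr
        exact Real.sum_mul_le_sqrt_mul_sqrt _ _ _
    _ = _ := by
        simp only [sq_abs, one_pow, Finset.sum_const, Finset.card_univ, Fintype.card_fin,
          nsmul_eq_mul, mul_one, hB]
        ring
end
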